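/- Let (A, Z, f, g, h) be a contraction and let δ_μ = δ + δ(μ), μ ∈ G(A), be a codifferential on BA corresponding to an A∞-algebra structure on A, such that 1 + δ(μ_{(1)})h : A → A is invertible. Then the codifferential ∂_* on BZ constructed by the tensor trick induces an A∞-algebra structure on Z, and 𝕗_* : BA → BZ and 𝕘_* : BZ → BA are quasi-isomorphisms of A∞-algebras. -/

import Mathlib

/-!
Framework: contractions of complexes and the tensor trick on bar constructions,
over a field `F` of characteristic zero.

A complex is a graded module, presented by a module with a homogeneity predicate
(`HA : A → ℤ → Prop`, with the homogeneous elements spanning) and a differential of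
degree `+1` squaring to zero.  A contraction `(A, Z, f, g, h)` is packaged by
`Contraction`.  The bar construction `BA = ⊕_{k≥1} (sA)^{⊗k}` is realized inside
`TensorAlgebra F A`, with bar words `bar l = [a₁|…|a_k]`; `AdmW l ds` says the word has
homogeneous letters of the listed degrees.  The structure `BarData` packages: the bar
codifferential `dB1` induced by the differential of `A`, the (deconcatenation) coproduct
`cop`, a Hochschild cochain `mu ∈ G(A) = C*(A,A)` (a linear map `B₊A → A`, with
components `μ_{(k)}` its restrictions to the tensor powers) of degree `degmu`, the
coderivation `mucod = δ(μ)` of `BA` determined by `μ`, and the tensor-trick homotopy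
`hB = 𝕙` induced by the contraction; each operator is pinned down by its defining
formula on bar words.
-/

namespace TTrick

open TensorProduct

noncomputable section

def sg (F : Type) [Field F] (z : ℤ) : F := (-1 : F) ^ z

def om (ds : List ℤ) : ℤ := ds.sum - ds.length

variable (F : Type) [Field F] [CharZero F]
variable (A : Type) [AddCommGroup A] [Module F A]
variable (Z : Type) [AddCommGroup Z] [Module F Z]

/-- The bar word `[a₁|…|a_k]` inside the tensor algebra. -/
def bar (l : List A) : TensorAlgebra F A := (l.map (TensorAlgebra.ι F)).prod

/-- Admissible bar words: all letters homogeneous of the listed degrees. -/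
def AdmW (HA : A → ℤ → Prop) (l : List A) (ds : List ℤ) : Prop :=
  l.length = ds.length ∧ ∀ i, i < l.length → HA (l.getD i 0) (ds.getD i 0)

/-- A contraction `(A, Z, f, g, h)` of complexes: `fg = 1`, `gf = 1 - (dh + hd)`,
together with the side conditions `fh = 0`, `hg = 0`, `h² = 0`. -/
structure Contraction (HA : A → ℤ → Prop) (HZ : Z → ℤ → Prop)
    (dA : A →ₗ[F] A) (dZ : Z →ₗ[F] Z) where
  f : A →ₗ[F] Z
  g : Z →ₗ[F] A
  h : A →ₗ[F] A
  fg : f ∘ₗ g = LinearMap.id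
  gf : g ∘ₗ f = LinearMap.id - (dA ∘ₗ h + h ∘ₗ dA)
  fh : f ∘ₗ h = 0
  hg : h ∘ₗ g = 0
  hh : h ∘ₗ h = 0
  fchain : f ∘ₗ dA = dZ ∘ₗ f
  gchain : g ∘ₗ dZ = dA ∘ₗ g
  fdeg : ∀ a m, HA a m → HZ (f a) m
  gdeg : ∀ z m, HZ z m → HA (g z) m
  hdeg : ∀ a m, HA a m → HA (h a) (m - 1)

variable {F A Z}

/-- The structure of a complex: homogeneous elements span, and the differential has
degree `+1` and squares to zero. -/
structure IsCx (HA : A → ℤ → Prop) (dA : A →ₗ[F] A) : Prop where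
  span_hom : Submodule.span F {a | ∃ m, HA a m} = ⊤
  d_sq : dA ∘ₗ dA = 0
  d_deg : ∀ a m, HA a m → HA (dA a) (m + 1)

variable (F A Z)

/-- The bar-construction data over a contraction: the bar codifferential, the
deconcatenation coproduct, a Hochschild cochain `μ` with its coderivation `δ(μ)`, and
the tensor-trick homotopy `𝕙`. -/
structure BarData (HA : A → ℤ → Prop) (HZ : Z → ℤ → Prop)
    (dA : A →ₗ[F] A) (dZ : Z →ₗ[F] Z)
    (C : Contraction F A Z HA HZ dA dZ) where
  /-- The bar codifferential `δ` of `BA` induced by the differential of `A`. -/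
  dB1 : TensorAlgebra F A →ₗ[F] TensorAlgebra F A
  /-- The (reduced, deconcatenation) coproduct of `BA`. -/
  cop : TensorAlgebra F A →ₗ[F] TensorAlgebra F A ⊗[F] TensorAlgebra F A
  /-- A Hochschild cochain `μ ∈ G(A) = C*(A,A)`, i.e. a map `B₊A → A`. -/
  mu : TensorAlgebra F A →ₗ[F] A
  /-- The degree of the cochain `μ`. -/
  degmu : ℤ
  /-- The coderivation `δ(μ)` of `BA` determined by `μ`. -/
  mucod : TensorAlgebra F A →ₗ[F] TensorAlgebra F A
  /-- The tensor-trick homotopy `𝕙` on `BA`. -/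
  hB : TensorAlgebra F A →ₗ[F] TensorAlgebra F A
  dB1_bar : ∀ l ds, AdmW A HA l ds →
      dB1 (bar F A l) = ∑ j ∈ Finset.range l.length,
        sg F (om (ds.take j)) • bar F A (l.set j (dA (l.getD j 0)))
  cop_bar : ∀ l : List A,
      cop (bar F A l) = ∑ j ∈ Finset.Ioo 0 l.length,
        bar F A (l.take j) ⊗ₜ[F] bar F A (l.drop j)
  mu_deg : ∀ l ds, AdmW A HA l ds → HA (mu (bar F A l)) (om ds + degmu)
  /-- `δ(μ)[a₁|…|a_k] = Σ_{0≤i<j≤k} (-1)^{(|μ|-1)ω_i} [a₁|…|μ[a_{i+1}|…|a_j]|…|a_k]`. -/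
  mucod_bar : ∀ l ds, AdmW A HA l ds →
      mucod (bar F A l) = ∑ j ∈ Finset.Icc 1 l.length, ∑ i ∈ Finset.range j,
        sg F ((degmu - 1) * om (ds.take i)) •
          bar F A (l.take i ++ [mu (bar F A ((l.take j).drop i))] ++ l.drop j)
  /-- `𝕙[a₁|…|a_k] = Σ_j (-1)^{ω_{j-1}} [pa₁|…|pa_{j-1}|ha_j|a_{j+1}|…|a_k]`,
  where `p = gf`. -/
  hB_bar : ∀ l ds, AdmW A HA l ds →
      hB (bar F A l) = ∑ j ∈ Finset.range l.length,
        sg F (om (ds.take j)) •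
          bar F A ((l.take j).map (C.g ∘ₗ C.f) ++ [C.h (l.getD j 0)] ++ l.drop (j + 1))

end

end TTrick

open TTrick

namespace TTrick

noncomputable section

variable (F : Type) [Field F] [CharZero F]
variable (Z : Type) [AddCommGroup Z] [Module F Z]

open TensorProduct in
/-- Coalgebra data on the bar construction `BZ`: the deconcatenation coproduct and the
sign operator `(-1)^{degree}` (used to express the Koszul signs in the coderivation
property). -/
structure BarCo (HZ : Z → ℤ → Prop) where
  cop : TensorAlgebra F Z →ₗ[F] TensorAlgebra F Z ⊗[F] TensorAlgebra F Z
  kos : TensorAlgebra F Z →ₗ[F] TensorAlgebra F Z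
  cop_bar : ∀ l : List Z,
      cop (bar F Z l) = ∑ j ∈ Finset.Ioo 0 l.length,
        bar F Z (l.take j) ⊗ₜ[F] bar F Z (l.drop j)
  kos_bar : ∀ l ds, AdmW Z HZ l ds → kos (bar F Z l) = sg F (om ds) • bar F Z l

variable (A : Type) [AddCommGroup A] [Module F A]

/-- The morphism of coalgebras `BA → BZ` induced by a linear map `A → Z`
(`[a₁|…|a_k] ↦ [φa₁|…|φa_k]`). -/
def barMap (φ : A →ₗ[F] Z) : TensorAlgebra F A →ₗ[F] TensorAlgebra F Z :=
  (TensorAlgebra.lift F ((TensorAlgebra.ι F : Z →ₗ[F] TensorAlgebra F Z) ∘ₗ φ)).toLinearMap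

end

end TTrick

open TTrick TensorProduct

namespace TTrick

noncomputable section

variable (F : Type) [Field F] [CharZero F]
variable (A : Type) [AddCommGroup A] [Module F A]

/-- The projection of the bar construction onto its linear part `B₁A ≅ sA`. -/
structure BarProj where
  pi : TensorAlgebra F A →ₗ[F] A
  pi_one : ∀ a : A, pi (TensorAlgebra.ι F a) = a
  pi_other : ∀ l : List A, l.length ≠ 1 → pi (bar F A l) = 0

/-- `φ : (A, dA) → (Z, dZ)` is a quasi-isomorphism of complexes: the map induced on
homology is injective and surjective. -/
def IsQuasiIso {Z : Type} [AddCommGroup Z] [Module F Z]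
    (dA : A →ₗ[F] A) (dZ : Z →ₗ[F] Z) (φ : A →ₗ[F] Z) : Prop :=
  (∀ a, dA a = 0 → (∃ w, φ a = dZ w) → ∃ b, a = dA b) ∧
  (∀ z, dZ z = 0 → ∃ a w, dA a = 0 ∧ z = φ a + dZ w)

end

end TTrick

namespace TTrick

section Perturbation

variable {R M N : Type*} [CommRing R] [AddCommGroup M] [Module R M] [AddCommGroup N] [Module R N]

/-- A contraction of `(M, d)` onto `N`, a perturbation `μ` of `d`, and two-sided inverses
`T = (1 + μh)⁻¹` and `T' = (1 + hμ)⁻¹`. -/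
structure Perturbation (d μ h T T' : M →ₗ[R] M) (f : M →ₗ[R] N) (g : N →ₗ[R] M) : Prop where
  d_sq : ∀ x, d (d x) = 0
  perturbed_sq : ∀ x, d (d x) + d (μ x) + (μ (d x) + μ (μ x)) = 0
  fg : ∀ z, f (g z) = z
  gf : ∀ x, g (f x) = x - (d (h x) + h (d x))
  fh : ∀ x, f (h x) = 0
  hg : ∀ z, h (g z) = 0
  hh : ∀ x, h (h x) = 0
  right_inv : ∀ x, T x + μ (h (T x)) = x
  left_inv : ∀ x, T (x + μ (h x)) = x
  right_inv' : ∀ x, T' x + h (μ (T' x)) = x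
  left_inv' : ∀ x, T' (x + h (μ x)) = x

namespace Perturbation

variable {d μ h T T' : M →ₗ[R] M} {f : M →ₗ[R] N} {g : N →ₗ[R] M}
  (P : Perturbation d μ h T T' f g)

include P

theorem inv_homotopy (x : M) : T' (h x) = h (T x) := by
  conv_lhs => rw [← P.right_inv x, map_add, P.left_inv']

theorem inv_perturbation (x : M) : T (μ x) = μ (T' x) := by
  conv_lhs => rw [← P.right_inv' x, map_add, P.left_inv]

theorem inv_eq (x : M) : T x = x - μ (T' (h x)) := by
  rw [P.inv_homotopy]
  exact eq_sub_of_add_eq (P.right_inv x)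

theorem inv_eq' (x : M) : T' x = x - h (T (μ x)) := by
  rw [← P.inv_homotopy]
  exact eq_sub_of_add_eq (by rw [← map_add, P.left_inv'])

theorem f_inv_homotopy (x : M) : f (T (h x)) = 0 := by
  rw [P.inv_eq, P.hh]
  simp [P.fh]

theorem f_inv_g (z : N) : f (T (g z)) = z := by
  rw [P.inv_eq, P.hg]
  simp [P.fg]

theorem f_inv' (x : M) : f (T' x) = f x := by
  rw [P.inv_eq']
  simp [P.fh]

theorem f_inv_inv_g (z : N) : f (T (T' (g z))) = z := by
  rw [P.inv_eq' (g z), map_sub, map_sub, P.f_inv_homotopy, P.f_inv_g, sub_zero]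

theorem homotopy_inv' (x : M) : h (T' x) = h x := by
  rw [P.inv_eq']
  simp [P.hh]

theorem inv_g_f_inv (x : M) : T' (g (f (T x))) =
    x - (d (h (T x)) + μ (h (T x)) + h (T (d x + μ x))) := by
  have hx := P.right_inv x
  rw [← P.inv_homotopy (d x + μ x)]
  set y := T x
  have hw := P.right_inv' (h (d x + μ x))
  set w := T' (h (d x + μ x))
  have key : g (f y) = (x - (d (h y) + μ (h y) + w)) +
      h (μ (x - (d (h y) + μ (h y) + w))) := by
    have h₁ := congrArg h (P.perturbed_sq (h y))
    rw [← hx] at hw ⊢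
    simp only [P.d_sq, map_add, map_sub, map_zero, zero_add] at h₁ hw ⊢
    rw [P.gf]
    linear_combination (norm := module) hw + h₁
  rw [key, P.left_inv']

theorem perturbed_perturbed (x : M) : d (d x + μ x) + μ (d x + μ x) = 0 := by
  simpa only [map_add] using P.perturbed_sq x

theorem f_inv_perturbed_homotopy (x : M) : f (T (d (h x) + μ (h x))) = 0 := by
  have key : ∀ y, f (T (d (h (T y)) + μ (h (T y)))) = 0 := by
    intro y
    have h₁ := congrArg (fun z => f (T z)) (P.inv_g_f_inv y)
    simp only [P.f_inv_inv_g] at h₁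
    rw [map_sub, map_sub, map_add T, map_add f, P.f_inv_homotopy, add_zero] at h₁
    exact sub_eq_self.1 h₁.symm
  simpa only [P.left_inv] using key (x + μ (h x))

theorem homotopy_perturbed_inv_g (z : N) : h (T (d (T' (g z)) + μ (T' (g z)))) = 0 := by
  have h₁ := P.inv_g_f_inv (T' (g z))
  rw [P.f_inv_inv_g, ← P.inv_homotopy (T' (g z)), P.homotopy_inv', P.hg,
    map_zero T', map_zero d, map_zero μ, add_zero, zero_add] at h₁
  exact sub_eq_self.1 h₁.symm

/-- The perturbed differential of the small complex is `f(1 + μh)⁻¹(d + μ)g`. -/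
theorem f_perturbed_g (z : N) :
    f (d (g z)) + f (μ (T' (g z))) = f (T (d (g z) + μ (g z))) := by
  have h₁ : h (d (g z)) = 0 := by
    have h₂ := P.gf (g z)
    rw [P.fg, P.hg, map_zero, zero_add] at h₂
    exact sub_eq_self.1 h₂.symm
  rw [map_add, map_add, P.inv_perturbation, P.inv_eq (d (g z)), h₁]
  simp

theorem f_perturbed_inv_g (z : N) :
    f (T (d (T' (g z)) + μ (T' (g z)))) = f (d (g z)) + f (μ (T' (g z))) := by
  rw [P.f_perturbed_g]
  set y := T (μ (g z)) with hy
  have h₁ := P.f_inv_perturbed_homotopy y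
  rw [P.inv_eq' (g z), ← hy]
  simp only [map_add, map_sub] at h₁ ⊢
  linear_combination (norm := module) (-1 : ℤ) • h₁

theorem f_inv_chain (x : M) :
    f (d (g (f (T x)))) + f (μ (T' (g (f (T x))))) = f (T (d x + μ x)) := by
  have h₁ := P.f_perturbed_inv_g (f (T x))
  have h₂ := P.f_inv_perturbed_homotopy (T (d x + μ x))
  have h₃ := P.perturbed_perturbed (h (T x))
  rw [← h₁, P.inv_g_f_inv]
  have h₄ := congrArg (fun z => f (T z)) h₃
  simp only [map_add, map_sub, map_zero] at h₂ h₄ ⊢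
  linear_combination (norm := module) (-1 : ℤ) • h₂ - h₄

theorem inv_g_chain (z : N) : d (T' (g z)) + μ (T' (g z)) =
    T' (g (f (d (g z)) + f (μ (T' (g z))))) := by
  rw [← P.f_perturbed_inv_g, P.inv_g_f_inv, P.homotopy_perturbed_inv_g, P.perturbed_perturbed]
  simp

theorem f_perturbed_g_sq (z : N) :
    f (d (g (f (d (g z)) + f (μ (T' (g z)))))) + f (μ (T' (g (f (d (g z)) + f (μ (T' (g z))))))) =
      0 := by
  rw [P.f_perturbed_g z, P.f_inv_chain, P.perturbed_perturbed, map_zero, map_zero]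

section Coalgebra

open TensorProduct

variable {c : M →ₗ[R] M ⊗[R] M} {c' : N →ₗ[R] N ⊗[R] N} {σ : M →ₗ[R] M} {κ : N →ₗ[R] N}

theorem f_inv_comul (hμ : ∀ x, c (μ x) = map μ .id (c x) + map σ μ (c x))
    (hh : ∀ x, c (h x) = map h .id (c x) + map (σ ∘ₗ g ∘ₗ f) h (c x))
    (hf : ∀ x, c' (f x) = map f f (c x)) (hσ : ∀ x, σ (σ x) = x)
    (hσh : ∀ x, σ (h x) = -h (σ x)) (x : M) :
    c' (f (T x)) = map (f ∘ₗ T) (f ∘ₗ T) (c x) := by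
  have key : ∀ t, map (f ∘ₗ T) (f ∘ₗ T) (t + (map μ .id (map h .id t + map (σ ∘ₗ g ∘ₗ f) h t) +
      map σ μ (map h .id t + map (σ ∘ₗ g ∘ₗ f) h t))) = map f f t := by
    intro t
    induction t with
    | zero => simp
    | add t u ht hu =>
      rw [map_add (map f f), ← ht, ← hu]
      simp only [map_add]
      abel
    | tmul x y =>
      have h₁ : ∀ z, f (T (μ (h z))) = f z - f (T z) := by
        intro z
        rw [eq_sub_iff_add_eq', ← map_add, ← map_add, P.left_inv]
      simp only [map_add, map_tmul, LinearMap.comp_apply, LinearMap.id_apply, P.f_inv_homotopy,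
        hσh, map_neg, hσ, P.f_inv_g, h₁, tmul_zero, neg_zero, zero_tmul, sub_tmul, tmul_sub]
      abel
  rw [hf, ← key, ← hh, ← hμ, ← map_add, P.right_inv]

theorem eq_zero_of_tensor_fixed (hσ : ∀ x, σ (σ x) = x) (hσh : ∀ x, σ (h x) = -h (σ x))
    (hσf : ∀ x, f (σ x) = κ (f x)) (hσg : ∀ z, σ (g z) = g (κ z)) {v : M ⊗[R] M}
    (hv : v + (map h .id (map μ .id v + map σ μ v) +
      map (σ ∘ₗ g ∘ₗ f) h (map μ .id v + map σ μ v)) = 0) : v = 0 := by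
  have hhσ : ∀ z, h (σ z) = -σ (h z) := by
    intro z
    rw [hσh, neg_neg]
  have hgf : ∀ z, σ (g (f (σ z))) = g (f z) := by
    intro z
    rw [hσf, ← hσg, hσ]
  set L : M ⊗[R] M →ₗ[R] M ⊗[R] M := .id + (map h .id ∘ₗ (map μ .id + map σ μ) +
    map (σ ∘ₗ g ∘ₗ f) h ∘ₗ (map μ .id + map σ μ)) with hL
  have hLv : L v = 0 := hv
  have e₁ : map h .id ∘ₗ L = map h .id := by
    ext x y
    simp [hL, P.hh, hhσ, P.hg]
  have h₁ : map h .id v = 0 := by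
    rw [← e₁, LinearMap.comp_apply, hLv, map_zero]
  have e₂ : map .id h ∘ₗ L = map (.id + h ∘ₗ μ) .id ∘ₗ map .id h -
      map σ (h ∘ₗ μ) ∘ₗ map h .id := by
    ext x y
    simp [hL, P.hh, hhσ, add_tmul, neg_tmul]
    abel
  have hinv : T' ∘ₗ (.id + h ∘ₗ μ) = .id := LinearMap.ext P.left_inv'
  have h₂ : map .id h v = 0 := by
    have := congrArg (map T' .id) (LinearMap.congr_fun e₂ v)
    simpa only [LinearMap.comp_apply, LinearMap.sub_apply, hLv, h₁, map_zero, sub_zero,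
      map_map, hinv, LinearMap.id_comp, LinearMap.comp_id, eq_comm] using this
  have e₃ : map f .id ∘ₗ L = map .id (.id + h ∘ₗ μ) ∘ₗ map f .id +
      map (f ∘ₗ σ ∘ₗ g ∘ₗ f ∘ₗ μ) .id ∘ₗ map .id h := by
    ext x y
    simp [hL, P.fh, hgf, P.fg, tmul_add]
    abel
  have h₃ : map f .id v = 0 := by
    have := congrArg (map .id T') (LinearMap.congr_fun e₃ v)
    simpa only [LinearMap.comp_apply, LinearMap.add_apply, hLv, h₂, map_zero, add_zero,
      map_map, hinv, LinearMap.id_comp, LinearMap.comp_id, eq_comm] using this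
  have e₄ : L = map (.id + h ∘ₗ μ) .id - map σ μ ∘ₗ map h .id +
      map (σ ∘ₗ g ∘ₗ f ∘ₗ μ) .id ∘ₗ map .id h + map g (h ∘ₗ μ) ∘ₗ map f .id := by
    ext x y
    simp [hL, hhσ, hgf, add_tmul, neg_tmul]
    abel
  have := congrArg (map T' .id) (LinearMap.congr_fun e₄ v)
  simpa only [LinearMap.comp_apply, LinearMap.add_apply, LinearMap.sub_apply, hLv, h₁, h₂, h₃,
    map_zero, add_zero, sub_zero, map_map, hinv, LinearMap.id_comp, map_id, LinearMap.id_apply,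
    eq_comm] using this

theorem inv_g_comul (hμ : ∀ x, c (μ x) = map μ .id (c x) + map σ μ (c x))
    (hh : ∀ x, c (h x) = map h .id (c x) + map (σ ∘ₗ g ∘ₗ f) h (c x))
    (hg : ∀ z, c (g z) = map g g (c' z)) (hσ : ∀ x, σ (σ x) = x)
    (hσh : ∀ x, σ (h x) = -h (σ x)) (hσf : ∀ x, f (σ x) = κ (f x))
    (hσg : ∀ z, σ (g z) = g (κ z)) (z : N) :
    c (T' (g z)) = map (T' ∘ₗ g) (T' ∘ₗ g) (c' z) := by
  have key : ∀ t, map (T' ∘ₗ g) (T' ∘ₗ g) t +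
      (map h .id (map μ .id (map (T' ∘ₗ g) (T' ∘ₗ g) t) + map σ μ (map (T' ∘ₗ g) (T' ∘ₗ g) t)) +
      map (σ ∘ₗ g ∘ₗ f) h (map μ .id (map (T' ∘ₗ g) (T' ∘ₗ g) t) +
        map σ μ (map (T' ∘ₗ g) (T' ∘ₗ g) t))) = map g g t := by
    intro t
    induction t with
    | zero => simp
    | add t u ht hu =>
      rw [map_add (map g g), ← ht, ← hu]
      simp only [map_add]
      abel
    | tmul x y =>
      have h₁ : ∀ z, h (μ (T' (g z))) = g z - T' (g z) := by
        intro z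
        rw [eq_sub_iff_add_eq', P.right_inv']
      have h₂ : ∀ z, h (σ z) = -σ (h z) := by
        intro z
        rw [hσh, neg_neg]
      have h₃ : ∀ z, σ (g (f (σ (T' (g z))))) = g z := by
        intro z
        rw [hσf, ← hσg, hσ, P.f_inv', P.fg]
      simp only [map_add, map_tmul, LinearMap.comp_apply, LinearMap.id_apply, P.homotopy_inv', P.hg,
        h₁, h₂, h₃, map_zero, neg_zero, tmul_zero, zero_tmul, sub_tmul, tmul_sub]
      abel
  rw [← sub_eq_zero]
  apply P.eq_zero_of_tensor_fixed hσ hσh hσf hσg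
  have h₁ : c (T' (g z)) + (map h .id (map μ .id (c (T' (g z))) + map σ μ (c (T' (g z)))) +
      map (σ ∘ₗ g ∘ₗ f) h (map μ .id (c (T' (g z))) + map σ μ (c (T' (g z))))) =
      map g g (c' z) := by
    rw [← hμ, ← hh, ← map_add, P.right_inv', hg]
  have h₂ := h₁.trans (key (c' z)).symm
  simp only [map_add, map_sub] at h₂ ⊢
  linear_combination (norm := module) h₂

theorem f_perturbed_g_comul (hd : ∀ x, c (d x) = map d .id (c x) + map σ d (c x))
    (hμ : ∀ x, c (μ x) = map μ .id (c x) + map σ μ (c x))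
    (hf : ∀ x, c' (f (T x)) = map (f ∘ₗ T) (f ∘ₗ T) (c x))
    (hg : ∀ z, c (g z) = map g g (c' z))
    (hσg : ∀ z, σ (g z) = g (κ z)) (z : N) :
    c' (f (d (g z)) + f (μ (T' (g z)))) =
      map (f ∘ₗ d ∘ₗ g + f ∘ₗ μ ∘ₗ T' ∘ₗ g) .id (c' z) +
        map κ (f ∘ₗ d ∘ₗ g + f ∘ₗ μ ∘ₗ T' ∘ₗ g) (c' z) := by
  have h₁ : f ∘ₗ d ∘ₗ g + f ∘ₗ μ ∘ₗ T' ∘ₗ g = (f ∘ₗ T) ∘ₗ (d + μ) ∘ₗ g :=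
    LinearMap.ext P.f_perturbed_g
  rw [P.f_perturbed_g, hf, map_add c, hd, hμ, hg, h₁]
  generalize c' z = t
  induction t with
  | zero => simp
  | add t u ht hu =>
    simp only [map_add] at ht hu ⊢
    linear_combination (norm := module) ht + hu
  | tmul x y =>
    simp only [map_add, map_tmul, LinearMap.comp_apply, LinearMap.id_apply, LinearMap.add_apply,
      P.f_inv_g, hσg, tmul_add, add_tmul]
    abel

end Coalgebra

end Perturbation
end Perturbation
end TTrick
namespace TTrick

theorem isQuasiIso_of_homotopy {F A Z : Type} [Field F] [AddCommGroup A] [Module F A]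
    [AddCommGroup Z] [Module F Z] {dA : A →ₗ[F] A} {dZ : Z →ₗ[F] Z} {f : A →ₗ[F] Z}
    {g : Z →ₗ[F] A} {h : A →ₗ[F] A} (hf : ∀ a, dZ (f a) = f (dA a))
    (hg : ∀ z, dA (g z) = g (dZ z)) (fg : ∀ z, f (g z) = z)
    (gf : ∀ a, g (f a) = a - (dA (h a) + h (dA a))) :
    IsQuasiIso F A dA dZ f ∧ IsQuasiIso F Z dZ dA g := by
  refine ⟨⟨?_, ?_⟩, ⟨?_, ?_⟩⟩
  · rintro a ha ⟨w, hw⟩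
    refine ⟨g w + h a, ?_⟩
    have := gf a
    rw [ha, map_zero, add_zero, hw, ← hg] at this
    rw [map_add, this, sub_add_cancel]
  · intro z hz
    exact ⟨g z, 0, by rw [hg, hz, map_zero], by rw [fg, map_zero, add_zero]⟩
  · rintro z hz ⟨w, hw⟩
    exact ⟨f w, by rw [hf, ← hw, fg]⟩
  · intro a ha
    refine ⟨f a, h a, by rw [hf, ha, map_zero], ?_⟩
    rw [gf, ha, map_zero, add_zero, sub_add_cancel]

section Words

variable {F : Type} [Field F]
variable {A : Type} [AddCommGroup A] [Module F A]
variable {Z : Type} [AddCommGroup Z] [Module F Z]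

open TensorAlgebra (ι)

theorem sg_add (m n : ℤ) : sg F (m + n) = sg F m * sg F n :=
  zpow_add₀ (neg_ne_zero.2 one_ne_zero) m n

theorem sg_even {m : ℤ} (hm : Even m) : sg F m = 1 := hm.neg_one_zpow

theorem sg_odd {m : ℤ} (hm : Odd m) : sg F m = -1 := hm.neg_one_zpow

theorem sg_mul_self (m : ℤ) : sg F m * sg F m = 1 := by
  rw [← sg_add, sg_even (Even.add_self m)]

theorem om_cons (m : ℤ) (ds : List ℤ) : om (m :: ds) = (m - 1) + om ds := by
  simp only [om, List.sum_cons, List.length_cons]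
  push_cast
  ring

@[simp] theorem om_nil : om [] = 0 := rfl

@[simp] theorem bar_nil : bar F A [] = 1 := rfl

@[simp] theorem bar_cons (a : A) (l : List A) : bar F A (a :: l) = ι F a * bar F A l := by
  simp [bar]

theorem bar_append (l l' : List A) : bar F A (l ++ l') = bar F A l * bar F A l' := by
  simp [bar]

variable (F) in
@[simp] theorem barMap_one (φ : A →ₗ[F] Z) : barMap F Z A φ 1 = 1 := by
  simp [barMap]

@[simp] theorem barMap_ι (φ : A →ₗ[F] Z) (a : A) : barMap F Z A φ (ι F a) = ι F (φ a) := by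
  simp [barMap]

@[simp] theorem barMap_mul (φ : A →ₗ[F] Z) (x y : TensorAlgebra F A) :
    barMap F Z A φ (x * y) = barMap F Z A φ x * barMap F Z A φ y := by
  simp [barMap]

theorem barMap_bar (φ : A →ₗ[F] Z) (l : List A) :
    barMap F Z A φ (bar F A l) = bar F Z (l.map φ) := by
  induction l with
  | nil => simp
  | cons a l ih => simp [ih]

theorem admW_nil (HA : A → ℤ → Prop) : AdmW A HA [] [] := ⟨rfl, by simp⟩

theorem AdmW.cons {HA : A → ℤ → Prop} {a : A} {m : ℤ} {l : List A} {ds : List ℤ} (ha : HA a m)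
    (h : AdmW A HA l ds) : AdmW A HA (a :: l) (m :: ds) := by
  refine ⟨by simp [h.1], ?_⟩
  rintro (_ | i) hi
  · simpa using ha
  · simpa using h.2 i (by simpa using hi)

/-- Induction over the tensor algebra, multiplying by letters on the left. -/
theorem left_induction {p : TensorAlgebra F A → Prop} (one : p 1)
    (cons : ∀ a y, p y → p (ι F a * y)) (add : ∀ x y, p x → p y → p (x + y))
    (smul : ∀ (r : F) x, p x → p (r • x)) (x : TensorAlgebra F A) : p x := by
  suffices ∀ y, p y → p (x * y) by simpa using this 1 one
  induction x using TensorAlgebra.induction with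
  | algebraMap r => intro y hy; simpa [Algebra.algebraMap_eq_smul_one] using smul r y hy
  | ι a => exact cons a
  | mul x y hx hy => intro z hz; rw [mul_assoc]; exact hx _ (hy _ hz)
  | add x y hx hy => intro z hz; rw [add_mul]; exact add _ _ (hx _ hz) (hy _ hz)

theorem left_ext {W : Type*} [AddCommGroup W] [Module F W] {φ ψ : TensorAlgebra F A →ₗ[F] W}
    (one : φ 1 = ψ 1) (cons : ∀ a y, φ y = ψ y → φ (ι F a * y) = ψ (ι F a * y)) : φ = ψ := by
  ext x
  induction x using left_induction with
  | one => exact one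
  | cons a y h => exact cons a y h
  | add x y hx hy => rw [map_add, map_add, hx, hy]
  | smul r x hx => rw [map_smul, map_smul, hx]

theorem span_adm {HA : A → ℤ → Prop} (hspan : Submodule.span F {a | ∃ m, HA a m} = ⊤) :
    Submodule.span F {x | ∃ l ds, AdmW A HA l ds ∧ bar F A l = x} = ⊤ := by
  rw [eq_top_iff]
  rintro x -
  induction x using left_induction with
  | one => exact Submodule.subset_span ⟨[], [], admW_nil HA, rfl⟩
  | add x y hx hy => exact add_mem hx hy
  | smul r x hx => exact Submodule.smul_mem _ r hx
  | cons a y hy =>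
    have ha : a ∈ Submodule.span F {a | ∃ m, HA a m} := hspan ▸ Submodule.mem_top
    induction ha, hy using Submodule.span_induction₂ with
    | mem_mem a y ha hy =>
      obtain ⟨m, ha⟩ := ha
      obtain ⟨l, ds, h, rfl⟩ := hy
      exact Submodule.subset_span ⟨a :: l, m :: ds, h.cons ha, bar_cons a l⟩
    | zero_left y hy => simp
    | zero_right x hx => simp
    | add_left x y z _ _ _ h₁ h₂ => rw [map_add, add_mul]; exact add_mem h₁ h₂
    | add_right x y z _ _ _ h₁ h₂ => rw [mul_add]; exact add_mem h₁ h₂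
    | smul_left r x y _ _ h => rw [map_smul, smul_mul_assoc]; exact Submodule.smul_mem _ r h
    | smul_right r x y _ _ h => rw [mul_smul_comm]; exact Submodule.smul_mem _ r h

theorem adm_ext {HA : A → ℤ → Prop} (hspan : Submodule.span F {a | ∃ m, HA a m} = ⊤)
    {W : Type*} [AddCommGroup W] [Module F W] {φ ψ : TensorAlgebra F A →ₗ[F] W}
    (h : ∀ l ds, AdmW A HA l ds → φ (bar F A l) = ψ (bar F A l)) : φ = ψ := by
  refine LinearMap.ext_on (span_adm hspan) ?_
  rintro _ ⟨l, ds, hl, rfl⟩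
  exact h l ds hl

theorem adm_ext₂ {HA : A → ℤ → Prop} (hspan : Submodule.span F {a | ∃ m, HA a m} = ⊤)
    {W : Type*} [AddCommGroup W] [Module F W] {φ ψ : A →ₗ[F] TensorAlgebra F A →ₗ[F] W}
    (h : ∀ a m l ds, HA a m → AdmW A HA l ds → φ a (bar F A l) = ψ a (bar F A l)) : φ = ψ := by
  refine LinearMap.ext_on hspan ?_
  rintro a ⟨m, ha⟩
  exact adm_ext hspan fun l ds hl => h a m l ds ha hl

theorem bar_ext {W : Type*} [AddCommGroup W] [Module F W] {φ ψ : TensorAlgebra F A →ₗ[F] W}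
    (h : ∀ l, φ (bar F A l) = ψ (bar F A l)) : φ = ψ :=
  adm_ext (HA := fun _ _ => True) (by simp) fun l _ _ => h l

/-! ### Deconcatenation -/

open TensorProduct

/-- The formula for the reduced deconcatenation coproduct on words. -/
def IsDeconc (c : TensorAlgebra F A →ₗ[F] TensorAlgebra F A ⊗[F] TensorAlgebra F A) : Prop :=
  ∀ l : List A, c (bar F A l) = ∑ j ∈ Finset.Ioo 0 l.length,
    bar F A (l.take j) ⊗ₜ[F] bar F A (l.drop j)

/-- The counital coproduct attached to a reduced coproduct `c`. -/
noncomputable def full (c : TensorAlgebra F A →ₗ[F] TensorAlgebra F A ⊗[F] TensorAlgebra F A) :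
    TensorAlgebra F A →ₗ[F] TensorAlgebra F A ⊗[F] TensorAlgebra F A :=
  c + (TensorProduct.mk F _ _).flip 1 + TensorProduct.mk F _ _ 1 -
    TensorAlgebra.algebraMapInv.toLinearMap.smulRight (1 ⊗ₜ 1)

theorem full_apply (c : TensorAlgebra F A →ₗ[F] TensorAlgebra F A ⊗[F] TensorAlgebra F A)
    (x : TensorAlgebra F A) :
    full c x = c x + x ⊗ₜ 1 + 1 ⊗ₜ x - TensorAlgebra.algebraMapInv x • (1 ⊗ₜ[F] 1) := by
  simp [full]

variable {c : TensorAlgebra F A →ₗ[F] TensorAlgebra F A ⊗[F] TensorAlgebra F A}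

theorem IsDeconc.one (hc : IsDeconc c) : c 1 = 0 := by
  simpa using hc []

theorem IsDeconc.full_one (hc : IsDeconc c) : full c 1 = 1 ⊗ₜ 1 := by
  simp [full_apply, hc.one]

theorem IsDeconc.full_bar (hc : IsDeconc c) (l : List A) : full c (bar F A l) =
    ∑ j ∈ Finset.range (l.length + 1), bar F A (l.take j) ⊗ₜ[F] bar F A (l.drop j) := by
  cases l with
  | nil => simp [hc.full_one]
  | cons a l =>
    rw [full_apply, hc]
    have h₁ : TensorAlgebra.algebraMapInv (bar F A (a :: l)) = 0 := by
      simp [TensorAlgebra.algebraMapInv]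
    have h₂ : Finset.Ioo 0 (a :: l).length = Finset.Ico 1 (a :: l).length := rfl
    rw [h₁, h₂, Finset.sum_range_succ, Finset.range_eq_Ico,
      Finset.sum_eq_sum_Ico_succ_bot (a := 0) (b := (a :: l).length) (by simp)]
    simp only [zero_smul, sub_zero, List.take_length, List.drop_length, List.take_zero,
      List.drop_zero, bar_nil, zero_add]
    abel

theorem IsDeconc.full_ι_mul (hc : IsDeconc c) (a : A) (y : TensorAlgebra F A) :
    full c (ι F a * y) =
      1 ⊗ₜ (ι F a * y) + TensorProduct.map (LinearMap.mulLeft F (ι F a)) .id (full c y) := by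
  suffices full c ∘ₗ LinearMap.mulLeft F (ι F a) = TensorProduct.mk F _ _ 1 ∘ₗ
      LinearMap.mulLeft F (ι F a) +
        TensorProduct.map (LinearMap.mulLeft F (ι F a)) .id ∘ₗ full c from
    LinearMap.congr_fun this y
  refine bar_ext fun l => ?_
  have := hc.full_bar (a :: l)
  simp only [LinearMap.comp_apply, LinearMap.add_apply, LinearMap.mulLeft_apply,
    TensorProduct.mk_apply]
  rw [← bar_cons, this, hc.full_bar, Finset.sum_range_succ']
  simp [map_sum, add_comm]

/-- Operators `R` with `Δ R = 1 ⊗ R + (R ⊗ 1) Δ`, such as left multiplication by a letter. -/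
def IsPrefixOp (c : TensorAlgebra F A →ₗ[F] TensorAlgebra F A ⊗[F] TensorAlgebra F A)
    (R : TensorAlgebra F A →ₗ[F] TensorAlgebra F A) : Prop :=
  ∀ y, full c (R y) = 1 ⊗ₜ R y + TensorProduct.map R .id (full c y)

theorem full_comp_of_rec (hc : IsDeconc c) {X : TensorAlgebra F A →ₗ[F] TensorAlgebra F A}
    {R : A → TensorAlgebra F A →ₗ[F] TensorAlgebra F A} {β : A →ₗ[F] A} (h₁ : X 1 = 0)
    (hX : ∀ a y, X (ι F a * y) = R a y + ι F (β a) * X y) (hR : ∀ a, IsPrefixOp c (R a))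
    (x : TensorAlgebra F A) : full c (X x) = TensorProduct.map X .id (full c x) +
      TensorProduct.map (barMap F A A β) X (full c x) := by
  induction x using left_induction with
  | one => simp [h₁, hc.full_one]
  | add x y hx hy =>
    simp only [map_add, hx, hy]
    abel
  | smul r x hx => simp only [map_smul, hx, smul_add]
  | cons a y hy =>
    rw [hX, map_add, hR, hc.full_ι_mul, hc.full_ι_mul, hy]
    have key : ∀ t, TensorProduct.map X .id (TensorProduct.map (.mulLeft F (ι F a)) .id t) +
        TensorProduct.map (barMap F A A β) X (TensorProduct.map (.mulLeft F (ι F a)) .id t) =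
        TensorProduct.map (R a) .id t + TensorProduct.map (.mulLeft F (ι F (β a))) .id
          (TensorProduct.map X .id t + TensorProduct.map (barMap F A A β) X t) := by
      intro t
      induction t with
      | zero => simp
      | add t u ht hu =>
        simp only [map_add] at ht hu ⊢
        linear_combination (norm := module) ht + hu
      | tmul x y =>
        simp only [map_tmul, map_add, LinearMap.mulLeft_apply, LinearMap.id_apply, hX, barMap_mul,
          barMap_ι, add_tmul]
        abel
    have := key (full c y)
    simp only [map_add, map_tmul, barMap_one, h₁, zero_tmul, LinearMap.id_apply, hX,
      tmul_add] at this ⊢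
    linear_combination (norm := module) (-1 : F) • this

theorem comul_of_rec (hc : IsDeconc c) {X : TensorAlgebra F A →ₗ[F] TensorAlgebra F A}
    {R : A → TensorAlgebra F A →ₗ[F] TensorAlgebra F A} {β : A →ₗ[F] A} (h₁ : X 1 = 0)
    (hX : ∀ a y, X (ι F a * y) = R a y + ι F (β a) * X y) (hR : ∀ a, IsPrefixOp c (R a))
    (hε : ∀ a y, TensorAlgebra.algebraMapInv (R a y) = 0) (x : TensorAlgebra F A) :
    c (X x) = TensorProduct.map X .id (c x) + TensorProduct.map (barMap F A A β) X (c x) := by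
  have hεX : TensorAlgebra.algebraMapInv (X x) = 0 := by
    induction x using left_induction with
    | one => simp [h₁]
    | add x y hx hy => simp [hx, hy]
    | smul r x hx => simp [hx]
    | cons a y hy => simp [hX, hε, hy]
  have := full_comp_of_rec hc h₁ hX hR x
  simp only [full_apply, map_add, map_sub, map_smul, map_tmul, h₁, hεX, barMap_one, zero_tmul,
    tmul_zero, LinearMap.id_apply, smul_zero, zero_smul, sub_zero] at this
  linear_combination (norm := module) this

theorem IsDeconc.comul_barMap (hc : IsDeconc c)
    {c' : TensorAlgebra F Z →ₗ[F] TensorAlgebra F Z ⊗[F] TensorAlgebra F Z} (hc' : IsDeconc c')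
    (φ : A →ₗ[F] Z) (x : TensorAlgebra F A) :
    c' (barMap F Z A φ x) = TensorProduct.map (barMap F Z A φ) (barMap F Z A φ) (c x) := by
  suffices c' ∘ₗ barMap F Z A φ = TensorProduct.map (barMap F Z A φ) (barMap F Z A φ) ∘ₗ c from
    LinearMap.congr_fun this x
  refine bar_ext fun l => ?_
  simp only [LinearMap.comp_apply]
  rw [barMap_bar, hc, hc']
  simp [map_sum, barMap_bar, List.map_take, List.map_drop]

theorem IsDeconc.full_barMap (hc : IsDeconc c) (φ : A →ₗ[F] A) (x : TensorAlgebra F A) :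
    full c (barMap F A A φ x) =
      TensorProduct.map (barMap F A A φ) (barMap F A A φ) (full c x) := by
  have : TensorAlgebra.algebraMapInv (barMap F A A φ x) = TensorAlgebra.algebraMapInv x := by
    induction x using left_induction with
    | one => simp
    | add x y hx hy => simp [hx, hy]
    | smul r x hx => simp [hx]
    | cons a y hy => simp [TensorAlgebra.algebraMapInv]
  simp [full_apply, hc.comul_barMap hc, this]

/-- The operator `[a₁|…|a_k] ↦ Σ_j [φ[a₁|…|a_j]|a_{j+1}|…|a_k]`. -/
noncomputable def prefixOp
    (c : TensorAlgebra F A →ₗ[F] TensorAlgebra F A ⊗[F] TensorAlgebra F A)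
    (φ : TensorAlgebra F A →ₗ[F] A) : TensorAlgebra F A →ₗ[F] TensorAlgebra F A :=
  LinearMap.mul' F _ ∘ₗ TensorProduct.map (ι F ∘ₗ φ) .id ∘ₗ full c

theorem IsDeconc.prefixOp_one (hc : IsDeconc c) (φ : TensorAlgebra F A →ₗ[F] A) :
    prefixOp c φ 1 = ι F (φ 1) := by
  simp [prefixOp, hc.full_one]

theorem IsDeconc.prefixOp_ι_mul (hc : IsDeconc c) (φ : TensorAlgebra F A →ₗ[F] A) (a : A)
    (y : TensorAlgebra F A) : prefixOp c φ (ι F a * y) =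
      ι F (φ 1) * (ι F a * y) + prefixOp c (φ ∘ₗ .mulLeft F (ι F a)) y := by
  simp only [prefixOp, LinearMap.comp_apply, hc.full_ι_mul, map_add, map_tmul,
    LinearMap.mul'_apply, LinearMap.id_apply, add_right_inj, map_map]
  rfl

theorem IsDeconc.isPrefixOp_mulLeft (hc : IsDeconc c) (a : A) :
    IsPrefixOp c (.mulLeft F (ι F a)) :=
  hc.full_ι_mul a

theorem IsDeconc.isPrefixOp_prefixOp (hc : IsDeconc c) (φ : TensorAlgebra F A →ₗ[F] A) :
    IsPrefixOp c (prefixOp c φ) := by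
  intro y
  induction y using left_induction generalizing φ with
  | one =>
    have := hc.full_ι_mul (φ 1) 1
    simpa [hc.full_one, hc.prefixOp_one] using this
  | add x y hx hy =>
    simp only [map_add, hx, hy, tmul_add]
    abel
  | smul r x hx => simp only [map_smul, hx, smul_add, tmul_smul]
  | cons a y hy =>
    have key : ∀ t : TensorAlgebra F A ⊗[F] TensorAlgebra F A, TensorProduct.map (prefixOp c φ) .id
        (TensorProduct.map (.mulLeft F (ι F a)) .id t) =
        TensorProduct.map (.mulLeft F (ι F (φ 1))) .id
          (TensorProduct.map (.mulLeft F (ι F a)) .id t) +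
        TensorProduct.map (prefixOp c (φ ∘ₗ .mulLeft F (ι F a))) .id t := by
      intro t
      induction t with
      | zero => simp
      | add t u ht hu =>
        simp only [map_add] at ht hu ⊢
        linear_combination (norm := module) ht + hu
      | tmul x y => simp [hc.prefixOp_ι_mul, add_tmul]
    rw [hc.prefixOp_ι_mul, map_add, hc.full_ι_mul, hy, hc.full_ι_mul,
      map_add (TensorProduct.map (.mulLeft F (ι F (φ 1))) (.id (M := TensorAlgebra F A))),
      map_add (TensorProduct.map (prefixOp c φ) (.id (M := TensorAlgebra F A))), key]
    simp only [map_tmul, hc.prefixOp_one, LinearMap.mulLeft_apply, mul_one, LinearMap.id_apply,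
      tmul_add]
    abel

theorem algebraMapInv_prefixOp (φ : TensorAlgebra F A →ₗ[F] A) (y : TensorAlgebra F A) :
    TensorAlgebra.algebraMapInv (prefixOp c φ y) = 0 := by
  simp only [prefixOp, LinearMap.comp_apply]
  induction full c y with
  | zero => simp
  | add t u ht hu => simp only [map_add, ht, hu, add_zero]
  | tmul x y => simp [TensorAlgebra.algebraMapInv]

theorem IsDeconc.prefixOp_bar (hc : IsDeconc c) (φ : TensorAlgebra F A →ₗ[F] A) (l : List A) :
    prefixOp c φ (bar F A l) = ∑ j ∈ Finset.range (l.length + 1),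
      ι F (φ (bar F A (l.take j))) * bar F A (l.drop j) := by
  simp [prefixOp, hc.full_bar, map_sum]

theorem IsDeconc.prefixOp_comm (hc : IsDeconc c) {φ ψ : TensorAlgebra F A →ₗ[F] A}
    {s : A →ₗ[F] A} (h : ∀ x, s (φ x) = ψ (barMap F A A s x)) (y : TensorAlgebra F A) :
    barMap F A A s (prefixOp c φ y) = prefixOp c ψ (barMap F A A s y) := by
  simp only [prefixOp, LinearMap.comp_apply, hc.full_barMap]
  induction full c y with
  | zero => simp
  | add t u ht hu => simp only [map_add, ht, hu]
  | tmul x y => simp [h]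

/-! ### The operators of `BarData` on words with a distinguished first letter -/

section BarData

variable {HA : A → ℤ → Prop} {HZ : Z → ℤ → Prop} {dA : A →ₗ[F] A} {dZ : Z →ₗ[F] Z}
  {C : Contraction F A Z HA HZ dA dZ} (B : BarData F A Z HA HZ dA dZ C)

namespace BarData

theorem dB1_one : B.dB1 1 = 0 := by
  simpa using B.dB1_bar [] [] (admW_nil HA)

theorem hB_one : B.hB 1 = 0 := by
  simpa using B.hB_bar [] [] (admW_nil HA)

theorem mucod_one : B.mucod 1 = 0 := by
  simpa using B.mucod_bar [] [] (admW_nil HA)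

theorem isDeconc : IsDeconc B.cop := B.cop_bar

variable {B}

theorem dB1_ι_mul_bar {a : A} {m : ℤ} {l : List A} {ds : List ℤ} (ha : HA a m)
    (hl : AdmW A HA l ds) : B.dB1 (ι F a * bar F A l) =
      ι F (dA a) * bar F A l + sg F (m - 1) • (ι F a * B.dB1 (bar F A l)) := by
  rw [← bar_cons, B.dB1_bar _ _ (hl.cons ha), B.dB1_bar _ _ hl, List.length_cons,
    Finset.sum_range_succ', add_comm]
  simp [om_cons, sg_add, Finset.mul_sum, Finset.smul_sum, mul_smul, sg_even]

theorem hB_ι_mul_bar {a : A} {m : ℤ} {l : List A} {ds : List ℤ} (ha : HA a m)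
    (hl : AdmW A HA l ds) : B.hB (ι F a * bar F A l) =
      ι F (C.h a) * bar F A l + sg F (m - 1) • (ι F (C.g (C.f a)) * B.hB (bar F A l)) := by
  rw [← bar_cons, B.hB_bar _ _ (hl.cons ha), B.hB_bar _ _ hl, List.length_cons,
    Finset.sum_range_succ', add_comm]
  simp [om_cons, sg_add, Finset.mul_sum, Finset.smul_sum, mul_smul, sg_even]

theorem mucod_ι_mul_bar {a : A} {m : ℤ} {l : List A} {ds : List ℤ} (ha : HA a m)
    (hl : AdmW A HA l ds) : B.mucod (ι F a * bar F A l) =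
      prefixOp B.cop (B.mu ∘ₗ .mulLeft F (ι F a)) (bar F A l) +
        sg F ((B.degmu - 1) * (m - 1)) • (ι F a * B.mucod (bar F A l)) := by
  have hIcc : ∀ (n : ℕ) (u : ℕ → TensorAlgebra F A),
      ∑ j ∈ Finset.Icc 1 n, u j = ∑ j ∈ Finset.range n, u (j + 1) := by
    intro n u
    rw [← Finset.Ico_add_one_right_eq_Icc, Finset.sum_Ico_eq_sum_range]
    simp [add_comm]
  rw [← bar_cons, B.mucod_bar _ _ (hl.cons ha), B.mucod_bar _ _ hl, B.isDeconc.prefixOp_bar]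
  simp only [hIcc, List.length_cons]
  rw [Finset.sum_congr rfl fun j _ => Finset.sum_range_succ' _ j, Finset.sum_add_distrib,
    Finset.sum_range_succ' _ l.length, add_comm]
  simp [om_cons, mul_add, sg_add, Finset.mul_sum, Finset.smul_sum, mul_smul, sg_even, bar_append]

theorem dB1_ι_mul (hspan : Submodule.span F {a | ∃ m, HA a m} = ⊤) {s : A →ₗ[F] A}
    (hs : ∀ a m, HA a m → s a = sg F (m - 1) • a) (a : A) (y : TensorAlgebra F A) :
    B.dB1 (ι F a * y) = ι F (dA a) * y + ι F (s a) * B.dB1 y := by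
  suffices (LinearMap.mul F _ ∘ₗ ι F).compr₂ B.dB1 =
      LinearMap.mul F _ ∘ₗ ι F ∘ₗ dA + (LinearMap.mul F _ ∘ₗ ι F ∘ₗ s).compl₂ B.dB1 from
    LinearMap.congr_fun₂ this a y
  refine adm_ext₂ hspan fun a m l ds ha hl => ?_
  simp [dB1_ι_mul_bar ha hl, hs a m ha]

theorem hB_ι_mul (hspan : Submodule.span F {a | ∃ m, HA a m} = ⊤) {s : A →ₗ[F] A}
    (hs : ∀ a m, HA a m → s a = sg F (m - 1) • a) (a : A) (y : TensorAlgebra F A) :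
    B.hB (ι F a * y) = ι F (C.h a) * y + ι F (C.g (C.f (s a))) * B.hB y := by
  suffices (LinearMap.mul F _ ∘ₗ ι F).compr₂ B.hB = LinearMap.mul F _ ∘ₗ ι F ∘ₗ C.h +
      (LinearMap.mul F _ ∘ₗ ι F ∘ₗ C.g ∘ₗ C.f ∘ₗ s).compl₂ B.hB from
    LinearMap.congr_fun₂ this a y
  refine adm_ext₂ hspan fun a m l ds ha hl => ?_
  simp [hB_ι_mul_bar ha hl, hs a m ha]

theorem mucod_ι_mul (hspan : Submodule.span F {a | ∃ m, HA a m} = ⊤) {t : A →ₗ[F] A}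
    (ht : ∀ a m, HA a m → t a = sg F ((B.degmu - 1) * (m - 1)) • a) (a : A)
    (y : TensorAlgebra F A) : B.mucod (ι F a * y) =
      prefixOp B.cop (B.mu ∘ₗ .mulLeft F (ι F a)) y + ι F (t a) * B.mucod y := by
  have hp : ∀ a y, prefixOp B.cop (B.mu ∘ₗ .mulLeft F (ι F a)) y =
      (prefixOp B.cop B.mu - .mulLeft F (ι F (B.mu 1))) (ι F a * y) := by
    intro a y
    simp [B.isDeconc.prefixOp_ι_mul]
  suffices (LinearMap.mul F _ ∘ₗ ι F).compr₂ B.mucod =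
      (LinearMap.mul F _ ∘ₗ ι F).compr₂ (prefixOp B.cop B.mu - .mulLeft F (ι F (B.mu 1))) +
        (LinearMap.mul F _ ∘ₗ ι F ∘ₗ t).compl₂ B.mucod by
    rw [hp]
    exact LinearMap.congr_fun₂ this a y
  refine adm_ext₂ hspan fun a m l ds ha hl => ?_
  have := hp a (bar F A l)
  simp only [LinearMap.compr₂_apply, LinearMap.comp_apply, LinearMap.mul_apply',
    LinearMap.add_apply, LinearMap.compl₂_apply, ← this, ht a m ha, mucod_ι_mul_bar ha hl,
    map_smul, LinearMap.smul_apply]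

end BarData

theorem barMap_sign_bar {s : A →ₗ[F] A} (hs : ∀ a m, HA a m → s a = sg F (m - 1) • a)
    {l : List A} {ds : List ℤ} (hl : AdmW A HA l ds) :
    barMap F A A s (bar F A l) = sg F (om ds) • bar F A l := by
  induction l generalizing ds with
  | nil =>
    obtain rfl : ds = [] := by simpa using hl.1.symm
    simp [sg_even]
  | cons a l ih =>
    obtain _ | ⟨m, ds⟩ := ds
    · simpa using hl.1
    have ha : HA a m := by simpa using hl.2 0 (by simp)
    have hl' : AdmW A HA l ds := ⟨by simpa using hl.1, fun i hi => by
      simpa using hl.2 (i + 1) (by simpa using hi)⟩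
    rw [bar_cons, barMap_mul, barMap_ι, ih hl', hs a m ha, om_cons, sg_add, map_smul,
      smul_mul_smul_comm]

theorem AdmW.map {l : List A} {ds : List ℤ} (hl : AdmW A HA l ds) {φ : A → Z}
    (hφ : ∀ a m, HA a m → HZ (φ a) m) : AdmW Z HZ (l.map φ) ds := by
  refine ⟨by simpa using hl.1, fun i hi => ?_⟩
  have hi' : i < l.length := by simpa using hi
  have := hφ _ _ (hl.2 i hi')
  simpa [hi'] using this

theorem tmul_eq_zero_or {V W : Type*} [AddCommGroup V] [Module F V] [AddCommGroup W] [Module F W]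
    {v : V} {w : W} (h : v ⊗ₜ[F] w = 0) : v = 0 ∨ w = 0 := by
  by_contra! hvw
  obtain ⟨φ, hφ⟩ := Module.Projective.exists_dual_ne_zero F hvw.1
  obtain ⟨ψ, hψ⟩ := Module.Projective.exists_dual_ne_zero F hvw.2
  have := congrArg (TensorProduct.lid F F ∘ TensorProduct.map φ ψ) h
  simp [hφ, hψ] at this

/-- The parity operator of the suspension `sA` exists as soon as the sign-carrying structures
on `BA` and `BZ` do. -/
theorem exists_sign [CharZero F] (hspan : Submodule.span F {a | ∃ m, HA a m} = ⊤)
    (B : BarData F A Z HA HZ dA dZ C) (BZ : BarCo F Z HZ) :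
    ∃ s : A →ₗ[F] A, ∀ a m, HA a m → s a = sg F (m - 1) • a := by
  let P (e : ℤ) : Submodule F A := Submodule.span F {a | ∃ m, sg F (m - 1) = sg F e ∧ HA a m}
  have hP : ∀ e, ∀ v ∈ P e, (∀ b n, HA b n → B.dB1 (ι F v * ι F b) =
      ι F (dA v) * ι F b + sg F e • (ι F v * ι F (dA b))) ∧
      BZ.kos (ι F (C.f v)) = sg F e • ι F (C.f v) := by
    intro e v hv
    induction hv using Submodule.span_induction with
    | zero => simp
    | add x y _ _ hx hy =>
      refine ⟨fun b n hb => ?_, ?_⟩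
      · simp only [map_add, add_mul, hx.1 b n hb, hy.1 b n hb]
        module
      · simp only [map_add, hx.2, hy.2, smul_add]
    | smul r x _ hx =>
      refine ⟨fun b n hb => ?_, ?_⟩
      · simp only [map_smul, smul_mul_assoc, hx.1 b n hb]
        module
      · rw [map_smul, map_smul, map_smul, hx.2, smul_comm]
    | mem x hx =>
      obtain ⟨m, hm, hx⟩ := hx
      refine ⟨fun b n hb => ?_, ?_⟩
      · have h₁ := BarData.dB1_ι_mul_bar (B := B) hx ((admW_nil HA).cons hb)
        have h₂ := BarData.dB1_ι_mul_bar (B := B) hb (admW_nil HA)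
        simp only [bar_cons, bar_nil, mul_one, B.dB1_one, mul_zero, smul_zero, add_zero] at h₁ h₂
        rw [h₁, h₂, hm]
      · have := BZ.kos_bar [C.f x] [m] ((admW_nil HZ).cons (C.fdeg x m hx))
        simpa [om_cons, hm] using this
  have hdisj : Disjoint (P 0) (P 1) := by
    rw [Submodule.disjoint_def]
    intro v h₀ h₁
    obtain ⟨hd₀, hk₀⟩ := hP 0 v h₀
    obtain ⟨hd₁, hk₁⟩ := hP 1 v h₁
    rw [sg_even Even.zero, one_smul] at hk₀
    have hk : ι F (C.f v) = (0 : TensorAlgebra F Z) := by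
      rw [sg_odd odd_one, hk₀, neg_one_smul] at hk₁
      refine (smul_eq_zero_iff_right (two_ne_zero (α := F))).1 ?_
      linear_combination (norm := module) hk₁
    by_contra hv
    have hdA : dA = 0 := by
      refine LinearMap.ext_on hspan ?_
      rintro b ⟨n, hb⟩
      have h₂ := (hd₀ b n hb).symm.trans (hd₁ b n hb)
      rw [sg_even Even.zero, sg_odd odd_one] at h₂
      have h₃ : ι F v * ι F (dA b) = 0 := by
        refine (smul_eq_zero_iff_right (two_ne_zero (α := F))).1 ?_
        linear_combination (norm := module) h₂
      have h₄ := B.cop_bar [v, dA b]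
      have h₅ : Finset.Ioo 0 2 = {1} := rfl
      simp only [bar_cons, bar_nil, mul_one, h₃, map_zero, List.length_cons, List.length_nil,
        zero_add, Nat.reduceAdd, h₅, Finset.sum_singleton, List.take_succ_cons, List.take_zero,
        List.drop_succ_cons, List.drop_zero] at h₄
      simpa [hv] using tmul_eq_zero_or h₄.symm
    have h₂ := LinearMap.congr_fun C.gf v
    simp only [hdA, LinearMap.comp_apply, (TensorAlgebra.ι_eq_zero_iff F _).1 hk] at h₂
    exact hv (by simpa using h₂.symm)
  have hmem : ∀ a m, HA a m → a ∈ P 0 ∧ sg F (m - 1) = 1 ∨ a ∈ P 1 ∧ sg F (m - 1) = -1 := by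
    intro a m ha
    obtain hm | hm := Int.even_or_odd (m - 1)
    · exact .inl ⟨Submodule.subset_span ⟨m, by rw [sg_even hm, sg_even Even.zero], ha⟩,
        sg_even hm⟩
    · exact .inr ⟨Submodule.subset_span ⟨m, by rw [sg_odd hm, sg_odd odd_one], ha⟩, sg_odd hm⟩
  have hcodisj : Codisjoint (P 0) (P 1) := by
    rw [codisjoint_iff, eq_top_iff, ← hspan, Submodule.span_le]
    rintro a ⟨m, ha⟩
    obtain h | h := hmem a m ha
    · exact Submodule.mem_sup_left h.1
    · exact Submodule.mem_sup_right h.1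
  refine ⟨LinearMap.ofIsCompl ⟨hdisj, hcodisj⟩ (P 0).subtype (-(P 1).subtype), fun a m ha => ?_⟩
  obtain ⟨h, hm⟩ | ⟨h, hm⟩ := hmem a m ha
  · simpa [hm] using LinearMap.ofIsCompl_apply_left ⟨hdisj, hcodisj⟩ (φ := (P 0).subtype)
      (ψ := -(P 1).subtype) ⟨a, h⟩
  · simpa [hm] using LinearMap.ofIsCompl_apply_right ⟨hdisj, hcodisj⟩ (φ := (P 0).subtype)
      (ψ := -(P 1).subtype) ⟨a, h⟩

theorem barMap_barMap (ψ φ : A →ₗ[F] A) (x : TensorAlgebra F A) :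
    barMap F A A ψ (barMap F A A φ x) = barMap F A A (ψ ∘ₗ φ) x := by
  induction x using left_induction with
  | one => simp
  | cons a y h => simp [h]
  | add x y hx hy => simp only [map_add, hx, hy]
  | smul r x hx => simp only [map_smul, hx]

theorem barMap_id (x : TensorAlgebra F A) : barMap F A A .id x = x := by
  induction x using left_induction with
  | one => simp
  | cons a y h => simp [h]
  | add x y hx hy => simp only [map_add, hx, hy]
  | smul r x hx => simp only [map_smul, hx]

/-! ### Compatibility with the parity operator -/

theorem parity_barMap_g [CharZero F] {s : A →ₗ[F] A}
    (hs : ∀ a m, HA a m → s a = sg F (m - 1) • a) (hZ : IsCx HZ dZ)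
    (C : Contraction F A Z HA HZ dA dZ) (BZ : BarCo F Z HZ) (z : TensorAlgebra F Z) :
    barMap F A A s (barMap F A Z C.g z) = barMap F A Z C.g (BZ.kos z) := by
  suffices barMap F A A s ∘ₗ barMap F A Z C.g = barMap F A Z C.g ∘ₗ BZ.kos from
    LinearMap.congr_fun this z
  refine adm_ext hZ.span_hom fun l ds hl => ?_
  simp only [LinearMap.comp_apply, BZ.kos_bar l ds hl, map_smul, barMap_bar,
    barMap_sign_bar hs (hl.map C.gdeg)]

section Parity

variable {s : A →ₗ[F] A} (hs : ∀ a m, HA a m → s a = sg F (m - 1) • a) (hA : IsCx HA dA)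
include hs hA

theorem parity_parity (a : A) : s (s a) = a := by
  suffices s ∘ₗ s = .id from LinearMap.congr_fun this a
  refine LinearMap.ext_on hA.span_hom ?_
  rintro a ⟨m, ha⟩
  simp [hs a m ha, smul_smul, sg_mul_self]

theorem parity_d (a : A) : s (dA a) = -dA (s a) := by
  suffices s ∘ₗ dA = -(dA ∘ₗ s) from LinearMap.congr_fun this a
  refine LinearMap.ext_on hA.span_hom ?_
  rintro a ⟨m, ha⟩
  have : sg F (m + 1 - 1) = -sg F (m - 1) := by
    rw [add_sub_right_comm, sg_add, sg_odd odd_one, mul_neg_one]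
  rw [LinearMap.comp_apply, hs _ _ (hA.d_deg a m ha), this]
  simp [hs a m ha]

theorem parity_h (C : Contraction F A Z HA HZ dA dZ) (a : A) : s (C.h a) = -C.h (s a) := by
  suffices s ∘ₗ C.h = -(C.h ∘ₗ s) from LinearMap.congr_fun this a
  refine LinearMap.ext_on hA.span_hom ?_
  rintro a ⟨m, ha⟩
  have : sg F (m - 1 - 1) = -sg F (m - 1) := by
    rw [sub_eq_add_neg (m - 1), sg_add, sg_odd odd_one.neg, mul_neg_one]
  simp [hs a m ha, hs _ _ (C.hdeg a m ha), this]

theorem parity_gf (C : Contraction F A Z HA HZ dA dZ) (a : A) :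
    s (C.g (C.f a)) = C.g (C.f (s a)) := by
  suffices s ∘ₗ C.g ∘ₗ C.f = C.g ∘ₗ C.f ∘ₗ s from LinearMap.congr_fun this a
  refine LinearMap.ext_on hA.span_hom ?_
  rintro a ⟨m, ha⟩
  simp [hs a m ha, hs _ _ (C.gdeg _ m (C.fdeg a m ha))]

theorem barMap_parity_parity (x : TensorAlgebra F A) :
    barMap F A A s (barMap F A A s x) = x := by
  rw [barMap_barMap, show s ∘ₗ s = .id from LinearMap.ext (parity_parity hs hA), barMap_id]

theorem barMap_parity_dB1 (x : TensorAlgebra F A) :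
    barMap F A A s (B.dB1 x) = -B.dB1 (barMap F A A s x) := by
  induction x using left_induction with
  | one => simp [B.dB1_one]
  | add x y hx hy => simp only [map_add, hx, hy, neg_add]
  | smul r x hx => simp only [map_smul, hx, smul_neg]
  | cons a y hy =>
    simp only [B.dB1_ι_mul hA.span_hom hs, map_add, barMap_mul, barMap_ι, hy, parity_d hs hA,
      map_neg, neg_mul, mul_neg]
    abel

theorem barMap_parity_hB (x : TensorAlgebra F A) :
    barMap F A A s (B.hB x) = -B.hB (barMap F A A s x) := by
  induction x using left_induction with
  | one => simp [B.hB_one]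
  | add x y hx hy => simp only [map_add, hx, hy, neg_add]
  | smul r x hx => simp only [map_smul, hx, smul_neg]
  | cons a y hy =>
    simp only [B.hB_ι_mul hA.span_hom hs, map_add, barMap_mul, barMap_ι, hy, parity_h hs hA,
      parity_gf hs hA, map_neg, neg_mul, mul_neg]
    abel

theorem barMap_f_parity [CharZero F] (C : Contraction F A Z HA HZ dA dZ) (BZ : BarCo F Z HZ)
    (x : TensorAlgebra F A) :
    barMap F Z A C.f (barMap F A A s x) = BZ.kos (barMap F Z A C.f x) := by
  suffices barMap F Z A C.f ∘ₗ barMap F A A s = BZ.kos ∘ₗ barMap F Z A C.f from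
    LinearMap.congr_fun this x
  refine adm_ext hA.span_hom fun l ds hl => ?_
  simp only [LinearMap.comp_apply, barMap_sign_bar hs hl, map_smul, barMap_bar,
    BZ.kos_bar _ _ (hl.map C.fdeg)]

/-! ### The tensor trick contraction -/

theorem dB1_dB1 (x : TensorAlgebra F A) : B.dB1 (B.dB1 x) = 0 := by
  induction x using left_induction with
  | one => simp [B.dB1_one]
  | add x y hx hy => simp only [map_add, hx, hy, add_zero]
  | smul r x hx => simp only [map_smul, hx, smul_zero]
  | cons a y hy =>
    have hd : dA (dA a) = 0 := LinearMap.congr_fun hA.d_sq a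
    simp only [B.dB1_ι_mul hA.span_hom hs, map_add, hy, parity_d hs hA, hd, map_zero, map_neg,
      mul_zero, zero_mul, neg_mul]
    abel

theorem barMap_f_hB (x : TensorAlgebra F A) : barMap F Z A C.f (B.hB x) = 0 := by
  induction x using left_induction with
  | one => simp [B.hB_one]
  | add x y hx hy => simp only [map_add, hx, hy, add_zero]
  | smul r x hx => simp only [map_smul, hx, smul_zero]
  | cons a y hy =>
    have hfh : C.f (C.h a) = 0 := LinearMap.congr_fun C.fh a
    simp [B.hB_ι_mul hA.span_hom hs, hy, hfh]

theorem hB_barMap_g (z : TensorAlgebra F Z) : B.hB (barMap F A Z C.g z) = 0 := by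
  induction z using left_induction with
  | one => simp [B.hB_one]
  | add x y hx hy => simp only [map_add, hx, hy, add_zero]
  | smul r x hx => simp only [map_smul, hx, smul_zero]
  | cons a y hy =>
    have hhg : C.h (C.g a) = 0 := LinearMap.congr_fun C.hg a
    simp [B.hB_ι_mul hA.span_hom hs, hy, hhg]

theorem hB_hB (x : TensorAlgebra F A) : B.hB (B.hB x) = 0 := by
  induction x using left_induction with
  | one => simp [B.hB_one]
  | add x y hx hy => simp only [map_add, hx, hy, add_zero]
  | smul r x hx => simp only [map_smul, hx, smul_zero]
  | cons a y hy =>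
    have hh : C.h (C.h a) = 0 := LinearMap.congr_fun C.hh a
    have hhg : ∀ z, C.h (C.g z) = 0 := LinearMap.congr_fun C.hg
    have hfh : ∀ b, C.f (C.h b) = 0 := LinearMap.congr_fun C.fh
    simp [B.hB_ι_mul hA.span_hom hs, hy, hh, hhg, hfh, parity_h hs hA]

theorem barMap_gf (x : TensorAlgebra F A) : barMap F A Z C.g (barMap F Z A C.f x) =
    x - (B.dB1 (B.hB x) + B.hB (B.dB1 x)) := by
  induction x using left_induction with
  | one => simp [B.hB_one, B.dB1_one]
  | add x y hx hy =>
    simp only [map_add, hx, hy]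
    abel
  | smul r x hx => simp only [map_smul, hx, smul_sub, smul_add]
  | cons a y hy =>
    have hfd : ∀ b, C.f (dA b) = dZ (C.f b) := LinearMap.congr_fun C.fchain
    have hgd : ∀ z, C.g (dZ z) = dA (C.g z) := LinearMap.congr_fun C.gchain
    have hgf : C.g (C.f a) = a - (dA (C.h a) + C.h (dA a)) := LinearMap.congr_fun C.gf a
    have key : ι F (C.g (C.f a)) * y = ι F a * y - ι F (dA (C.h a) + C.h (dA a)) * y := by
      rw [hgf, map_sub, sub_mul]
    simp only [B.dB1_ι_mul hA.span_hom hs, B.hB_ι_mul hA.span_hom hs, map_add, barMap_mul,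
      barMap_ι, hy, parity_d hs hA, parity_h hs hA, parity_gf hs hA, parity_parity hs hA, hfd, hgd,
      map_neg, neg_mul, mul_sub, mul_add, key, add_mul]
    abel

end Parity

theorem barMap_f_barMap_g (C : Contraction F A Z HA HZ dA dZ) (z : TensorAlgebra F Z) :
    barMap F Z A C.f (barMap F A Z C.g z) = z := by
  induction z using left_induction with
  | one => simp
  | add x y hx hy => simp only [map_add, hx, hy]
  | smul r x hx => simp only [map_smul, hx]
  | cons a y hy =>
    have hfg : C.f (C.g a) = a := LinearMap.congr_fun C.fg a
    simp [hy, hfg]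

section Coproduct

variable {s : A →ₗ[F] A} (hs : ∀ a m, HA a m → s a = sg F (m - 1) • a) (hA : IsCx HA dA)
include hs hA

theorem cop_dB1 (x : TensorAlgebra F A) : B.cop (B.dB1 x) =
    TensorProduct.map B.dB1 .id (B.cop x) +
      TensorProduct.map (barMap F A A s) B.dB1 (B.cop x) :=
  comul_of_rec B.isDeconc B.dB1_one (R := fun a => .mulLeft F (ι F (dA a)))
    (fun a y => B.dB1_ι_mul hA.span_hom hs a y) (fun a => B.isDeconc.isPrefixOp_mulLeft (dA a))
    (fun a y => by simp [TensorAlgebra.algebraMapInv]) x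

theorem cop_hB (x : TensorAlgebra F A) : B.cop (B.hB x) =
    TensorProduct.map B.hB .id (B.cop x) +
      TensorProduct.map (barMap F A A s ∘ₗ barMap F A Z C.g ∘ₗ barMap F Z A C.f) B.hB
        (B.cop x) := by
  have : barMap F A A s ∘ₗ barMap F A Z C.g ∘ₗ barMap F Z A C.f =
      barMap F A A (C.g ∘ₗ C.f ∘ₗ s) := by
    refine left_ext (by simp) fun a y h => ?_
    simp only [LinearMap.comp_apply] at h
    simp [h, parity_gf hs hA C]
  rw [this]
  exact comul_of_rec B.isDeconc B.hB_one (R := fun a => .mulLeft F (ι F (C.h a)))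
    (fun a y => B.hB_ι_mul hA.span_hom hs a y) (fun a => B.isDeconc.isPrefixOp_mulLeft (C.h a))
    (fun a y => by simp [TensorAlgebra.algebraMapInv]) x

omit hs in
theorem cop_mucod {t : A →ₗ[F] A}
    (ht : ∀ a m, HA a m → t a = sg F ((B.degmu - 1) * (m - 1)) • a) (x : TensorAlgebra F A) :
    B.cop (B.mucod x) = TensorProduct.map B.mucod .id (B.cop x) +
      TensorProduct.map (barMap F A A t) B.mucod (B.cop x) :=
  comul_of_rec B.isDeconc B.mucod_one
    (R := fun a => prefixOp B.cop (B.mu ∘ₗ .mulLeft F (ι F a)))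
    (fun a y => B.mucod_ι_mul hA.span_hom ht a y) (fun _ => B.isDeconc.isPrefixOp_prefixOp _)
    (fun _ _ => algebraMapInv_prefixOp _ _) x

theorem barMap_parity_mucod (hμ : Odd B.degmu) (x : TensorAlgebra F A) :
    barMap F A A s (B.mucod x) = B.mucod (barMap F A A s x) := by
  have ht : ∀ a m, HA a m → LinearMap.id (R := F) a = sg F ((B.degmu - 1) * (m - 1)) • a := by
    intro a m _
    rw [sg_even ((hμ.sub_odd odd_one).mul_right _), one_smul, LinearMap.id_apply]
  have hmu : ∀ x, s (B.mu x) = B.mu (barMap F A A s x) := by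
    intro x
    suffices s ∘ₗ B.mu = B.mu ∘ₗ barMap F A A s from LinearMap.congr_fun this x
    refine adm_ext hA.span_hom fun l ds hl => ?_
    simp only [LinearMap.comp_apply, barMap_sign_bar hs hl, hs _ _ (B.mu_deg l ds hl), map_smul,
      add_sub_assoc, sg_add, sg_even (hμ.sub_odd odd_one), mul_one]
  induction x using left_induction with
  | one => simp [B.mucod_one]
  | add x y hx hy => simp only [map_add, hx, hy]
  | smul r x hx => simp only [map_smul, hx]
  | cons a y hy =>
    simp only [B.mucod_ι_mul hA.span_hom ht, map_add, barMap_mul, barMap_ι, hy,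
      LinearMap.id_apply]
    rw [B.isDeconc.prefixOp_comm (ψ := B.mu ∘ₗ .mulLeft F (ι F (s a)))]
    simp [hmu]

/-- A Maurer–Cartan cochain of odd degree acts trivially. -/
theorem mucod_eq_zero [CharZero F] (hμ : Odd B.degmu)
    (hcodiff : (B.dB1 + B.mucod) ∘ₗ (B.dB1 + B.mucod) = 0) : B.mucod = 0 := by
  have hsq : ∀ x, B.mucod (B.mucod x) = 0 := by
    intro x
    have h : ∀ x, B.dB1 (B.mucod x) + B.mucod (B.dB1 x) + B.mucod (B.mucod x) = 0 := by
      intro x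
      have := LinearMap.congr_fun hcodiff x
      simp only [LinearMap.comp_apply, LinearMap.add_apply, map_add, dB1_dB1 B hs hA,
        LinearMap.zero_apply, zero_add] at this
      rw [← this]
      abel
    have h₁ := congrArg (barMap F A A s) (h (barMap F A A s x))
    simp only [map_add, barMap_parity_dB1 B hs hA, barMap_parity_mucod B hs hA hμ,
      barMap_parity_parity hs hA, map_zero, map_neg] at h₁
    refine (smul_eq_zero_iff_right (two_ne_zero (α := F))).1 ?_
    linear_combination (norm := module) h₁ + h x
  have ht : ∀ a m, HA a m → LinearMap.id (R := F) a = sg F ((B.degmu - 1) * (m - 1)) • a := by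
    intro a m _
    rw [sg_even ((hμ.sub_odd odd_one).mul_right _), one_smul, LinearMap.id_apply]
  have hcop : ∀ x, B.cop (B.mucod x) = TensorProduct.map B.mucod .id (B.cop x) +
      TensorProduct.map .id B.mucod (B.cop x) := by
    intro x
    rw [cop_mucod B hA ht, show barMap F A A .id = .id from LinearMap.ext barMap_id]
  have hmap : ∀ x, TensorProduct.map B.mucod B.mucod (B.cop x) = 0 := by
    intro x
    have key : ∀ u, TensorProduct.map B.mucod .id
          (TensorProduct.map B.mucod .id u + TensorProduct.map .id B.mucod u) +
        TensorProduct.map .id B.mucod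
          (TensorProduct.map B.mucod .id u + TensorProduct.map .id B.mucod u) =
        (2 : F) • TensorProduct.map B.mucod B.mucod u := by
      intro u
      induction u with
      | zero => simp
      | add t u ht hu =>
        simp only [map_add, smul_add] at ht hu ⊢
        linear_combination (norm := module) ht + hu
      | tmul x y =>
        simp only [map_tmul, map_add, hsq, LinearMap.id_apply, zero_tmul, tmul_zero]
        module
    have := hcop (B.mucod x)
    rw [hsq, map_zero, hcop, key] at this
    exact (smul_eq_zero_iff_right (two_ne_zero (α := F))).1 this.symm
  suffices ∀ n, ∀ l : List A, l.length = n → B.mucod (bar F A l) = 0 from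
    bar_ext fun l => by simpa using this _ l rfl
  intro n
  induction n using Nat.strong_induction_on with
  | _ n ih =>
    rintro l rfl
    obtain rfl | hl := eq_or_ne l []
    · simp [B.mucod_one]
    have hpos : 0 < l.length := List.length_pos_iff.2 hl
    have h := hmap (bar F A (l ++ l))
    rw [B.cop_bar, map_sum, Finset.sum_eq_single l.length] at h
    · exact or_self_iff.1 (tmul_eq_zero_or (by simpa using h))
    · intro j hj hne
      rw [Finset.mem_Ioo, List.length_append] at hj
      rw [map_tmul]
      obtain hlt | hgt := hne.lt_or_gt
      · rw [ih j hlt _ (by simp; omega), zero_tmul]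
      · rw [ih (l.length + l.length - j) (by omega) (List.drop j _) (by simp), tmul_zero]
    · intro h
      exact absurd (Finset.mem_Ioo.2 ⟨hpos, by simpa using hpos⟩) h

theorem cop_mucod_parity [CharZero F]
    (hcodiff : (B.dB1 + B.mucod) ∘ₗ (B.dB1 + B.mucod) = 0) (x : TensorAlgebra F A) :
    B.cop (B.mucod x) = TensorProduct.map B.mucod .id (B.cop x) +
      TensorProduct.map (barMap F A A s) B.mucod (B.cop x) := by
  obtain hμ | hμ := Int.even_or_odd B.degmu
  · refine cop_mucod B hA (fun a m ha => ?_) x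
    rw [hs a m ha]
    obtain hm | hm := Int.even_or_odd (m - 1)
    · rw [sg_even hm, sg_even (hm.mul_left _)]
    · rw [sg_odd hm, sg_odd ((hμ.sub_odd odd_one).mul hm)]
  · simp [mucod_eq_zero B hs hA hμ hcodiff]

end Coproduct

theorem perturbation {s : A →ₗ[F] A} (hs : ∀ a m, HA a m → s a = sg F (m - 1) • a)
    (hA : IsCx HA dA) (hcodiff : (B.dB1 + B.mucod) ∘ₗ (B.dB1 + B.mucod) = 0)
    {T T' : TensorAlgebra F A →ₗ[F] TensorAlgebra F A}
    (hT : (LinearMap.id + B.mucod ∘ₗ B.hB) ∘ₗ T = LinearMap.id ∧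
      T ∘ₗ (LinearMap.id + B.mucod ∘ₗ B.hB) = LinearMap.id)
    (hT' : (LinearMap.id + B.hB ∘ₗ B.mucod) ∘ₗ T' = LinearMap.id ∧
      T' ∘ₗ (LinearMap.id + B.hB ∘ₗ B.mucod) = LinearMap.id) :
    Perturbation B.dB1 B.mucod B.hB T T' (barMap F Z A C.f) (barMap F A Z C.g) where
  d_sq := dB1_dB1 B hs hA
  perturbed_sq x := by simpa using LinearMap.congr_fun hcodiff x
  fg := barMap_f_barMap_g C
  gf := barMap_gf B hs hA
  fh := barMap_f_hB B hs hA
  hg := hB_barMap_g B hs hA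
  hh := hB_hB B hs hA
  right_inv := LinearMap.congr_fun hT.1
  left_inv := LinearMap.congr_fun hT.2
  right_inv' := LinearMap.congr_fun hT'.1
  left_inv' := LinearMap.congr_fun hT'.2

/-! ### Linear components -/

theorem ι_proj {pi : TensorAlgebra F A →ₗ[F] A} (hpi : ∀ a, pi (ι F a) = a)
    {x : TensorAlgebra F A} (hx : ∃ b, x = ι F b) : ι F (pi x) = x := by
  obtain ⟨b, rfl⟩ := hx
  rw [hpi]

theorem dB1_ι (hA : IsCx HA dA) (a : A) : B.dB1 (ι F a) = ι F (dA a) := by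
  suffices B.dB1 ∘ₗ ι F = ι F ∘ₗ dA from LinearMap.congr_fun this a
  refine LinearMap.ext_on hA.span_hom ?_
  rintro a ⟨m, ha⟩
  simpa [B.dB1_one] using BarData.dB1_ι_mul_bar (B := B) ha (admW_nil HA)

theorem hB_ι (hA : IsCx HA dA) (a : A) : B.hB (ι F a) = ι F (C.h a) := by
  suffices B.hB ∘ₗ ι F = ι F ∘ₗ C.h from LinearMap.congr_fun this a
  refine LinearMap.ext_on hA.span_hom ?_
  rintro a ⟨m, ha⟩
  simpa [B.hB_one] using BarData.hB_ι_mul_bar (B := B) ha (admW_nil HA)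

theorem mucod_ι (hA : IsCx HA dA) (a : A) : B.mucod (ι F a) = ι F (B.mu (ι F a)) := by
  suffices B.mucod ∘ₗ ι F = ι F ∘ₗ B.mu ∘ₗ ι F from LinearMap.congr_fun this a
  refine LinearMap.ext_on hA.span_hom ?_
  rintro a ⟨m, ha⟩
  simpa [sg_even] using B.mucod_bar _ _ ((admW_nil HA).cons ha)

theorem inv_ι (hA : IsCx HA dA) {T : TensorAlgebra F A →ₗ[F] TensorAlgebra F A}
    (hT : T ∘ₗ (LinearMap.id + B.mucod ∘ₗ B.hB) = LinearMap.id)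
    (hyp : Function.Surjective (LinearMap.id + B.mu ∘ₗ ι F ∘ₗ C.h : A →ₗ[F] A)) (a : A) :
    ∃ b, T (ι F a) = ι F b := by
  obtain ⟨b, rfl⟩ := hyp a
  refine ⟨b, ?_⟩
  simpa [hB_ι B hA, mucod_ι B hA] using LinearMap.congr_fun hT (ι F b)

end BarData
end Words
end TTrick

/-- Let `(A, Z, f, g, h)` be a contraction and let
`δ_μ = δ + δ(μ)`, `μ ∈ G(A)`, be a codifferential on `BA` corresponding to an
A∞-algebra structure on `A`, such that `1 + δ(μ_{(1)})h : A → A` is invertible.  Then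
the codifferential `∂⋆ = 𝕗δ𝕘 + 𝕗δ(μ)(1+𝕙δ(μ))⁻¹𝕘` on `BZ` constructed by the tensor
trick induces an A∞-algebra structure on `Z` (it is a coderivation of `BZ` of square
zero), and `𝕗⋆ = 𝕗(1+δ(μ)𝕙)⁻¹ : BA → BZ` and `𝕘⋆ = (1+𝕙δ(μ))⁻¹𝕘 : BZ → BA` are
quasi-isomorphisms of A∞-algebras: they are morphisms of the dg coalgebras
`(BA, Δ, δ_μ)` and `(BZ, Δ, ∂⋆)`, and their linear components are quasi-isomorphisms
of the underlying complexes. -/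
theorem tensor_trick_Ainfty_structure
    {F A Z : Type} [Field F] [CharZero F]
    [AddCommGroup A] [Module F A] [AddCommGroup Z] [Module F Z]
    (HA : A → ℤ → Prop) (HZ : Z → ℤ → Prop)
    (dA : A →ₗ[F] A) (dZ : Z →ₗ[F] Z)
    (hA : IsCx HA dA) (hZ : IsCx HZ dZ)
    (C : Contraction F A Z HA HZ dA dZ)
    (B : BarData F A Z HA HZ dA dZ C)
    (BZ : BarCo F Z HZ)
    (pA : BarProj F A) (pZ : BarProj F Z)
    -- `δ_μ = δ + δ(μ)` is a codifferential (an A∞-algebra structure on `A`) …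
    (hcodiff : (B.dB1 + B.mucod) ∘ₗ (B.dB1 + B.mucod) = 0)
    -- … and `1 + δ(μ_{(1)})h : A → A` is invertible,
    (hyp : Function.Bijective
      ⇑(LinearMap.id + B.mu ∘ₗ TensorAlgebra.ι F ∘ₗ C.h : A →ₗ[F] A))
    -- with `T = (1 + δ(μ)𝕙)⁻¹` and `T' = (1 + 𝕙δ(μ))⁻¹` (which exist, by Statement 12):
    (T T' : TensorAlgebra F A →ₗ[F] TensorAlgebra F A)
    (hT : (LinearMap.id + B.mucod ∘ₗ B.hB) ∘ₗ T = LinearMap.id ∧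
          T ∘ₗ (LinearMap.id + B.mucod ∘ₗ B.hB) = LinearMap.id)
    (hT' : (LinearMap.id + B.hB ∘ₗ B.mucod) ∘ₗ T' = LinearMap.id ∧
           T' ∘ₗ (LinearMap.id + B.hB ∘ₗ B.mucod) = LinearMap.id) :
    -- `∂⋆` is a codifferential on `BZ`, i.e. an A∞-algebra structure on `Z`:
    (BZ.cop ∘ₗ (barMap F Z A C.f ∘ₗ B.dB1 ∘ₗ barMap F A Z C.g +
        barMap F Z A C.f ∘ₗ B.mucod ∘ₗ T' ∘ₗ barMap F A Z C.g) =
      (TensorProduct.map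
          (barMap F Z A C.f ∘ₗ B.dB1 ∘ₗ barMap F A Z C.g +
            barMap F Z A C.f ∘ₗ B.mucod ∘ₗ T' ∘ₗ barMap F A Z C.g)
          (LinearMap.id : TensorAlgebra F Z →ₗ[F] TensorAlgebra F Z) +
        TensorProduct.map BZ.kos
          (barMap F Z A C.f ∘ₗ B.dB1 ∘ₗ barMap F A Z C.g +
            barMap F Z A C.f ∘ₗ B.mucod ∘ₗ T' ∘ₗ barMap F A Z C.g)) ∘ₗ BZ.cop) ∧
    ((barMap F Z A C.f ∘ₗ B.dB1 ∘ₗ barMap F A Z C.g +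
        barMap F Z A C.f ∘ₗ B.mucod ∘ₗ T' ∘ₗ barMap F A Z C.g) ∘ₗ
      (barMap F Z A C.f ∘ₗ B.dB1 ∘ₗ barMap F A Z C.g +
        barMap F Z A C.f ∘ₗ B.mucod ∘ₗ T' ∘ₗ barMap F A Z C.g) = 0) ∧
    -- `𝕗⋆` and `𝕘⋆` are morphisms of A∞-algebras (morphisms of dg coalgebras):
    (BZ.cop ∘ₗ (barMap F Z A C.f ∘ₗ T) =
        TensorProduct.map (barMap F Z A C.f ∘ₗ T) (barMap F Z A C.f ∘ₗ T) ∘ₗ B.cop) ∧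
    ((barMap F Z A C.f ∘ₗ B.dB1 ∘ₗ barMap F A Z C.g +
        barMap F Z A C.f ∘ₗ B.mucod ∘ₗ T' ∘ₗ barMap F A Z C.g) ∘ₗ
          (barMap F Z A C.f ∘ₗ T) =
        (barMap F Z A C.f ∘ₗ T) ∘ₗ (B.dB1 + B.mucod)) ∧
    (B.cop ∘ₗ (T' ∘ₗ barMap F A Z C.g) =
        TensorProduct.map (T' ∘ₗ barMap F A Z C.g) (T' ∘ₗ barMap F A Z C.g) ∘ₗ BZ.cop) ∧
    ((B.dB1 + B.mucod) ∘ₗ (T' ∘ₗ barMap F A Z C.g) =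
        (T' ∘ₗ barMap F A Z C.g) ∘ₗ
          (barMap F Z A C.f ∘ₗ B.dB1 ∘ₗ barMap F A Z C.g +
            barMap F Z A C.f ∘ₗ B.mucod ∘ₗ T' ∘ₗ barMap F A Z C.g)) ∧
    -- and they are quasi-isomorphisms: their linear components are quasi-isomorphisms
    -- between `(A, m₁)` and `(Z, ∂⋆₍₁₎)`:
    IsQuasiIso F A
      (pA.pi ∘ₗ (B.dB1 + B.mucod) ∘ₗ TensorAlgebra.ι F)
      (pZ.pi ∘ₗ (barMap F Z A C.f ∘ₗ B.dB1 ∘ₗ barMap F A Z C.g +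
          barMap F Z A C.f ∘ₗ B.mucod ∘ₗ T' ∘ₗ barMap F A Z C.g) ∘ₗ TensorAlgebra.ι F)
      (pZ.pi ∘ₗ (barMap F Z A C.f ∘ₗ T) ∘ₗ TensorAlgebra.ι F) ∧
    IsQuasiIso F Z
      (pZ.pi ∘ₗ (barMap F Z A C.f ∘ₗ B.dB1 ∘ₗ barMap F A Z C.g +
          barMap F Z A C.f ∘ₗ B.mucod ∘ₗ T' ∘ₗ barMap F A Z C.g) ∘ₗ TensorAlgebra.ι F)
      (pA.pi ∘ₗ (B.dB1 + B.mucod) ∘ₗ TensorAlgebra.ι F)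
      (pA.pi ∘ₗ (T' ∘ₗ barMap F A Z C.g) ∘ₗ TensorAlgebra.ι F) := by
  obtain ⟨s, hs⟩ := exists_sign hA.span_hom B BZ
  have P := perturbation B hs hA hcodiff hT hT'
  have hfkos := barMap_f_parity hs hA C BZ
  have hgkos := parity_barMap_g hs hZ C BZ
  have hμ := cop_mucod_parity B hs hA hcodiff
  have hσ := barMap_parity_parity hs hA
  have hσh := barMap_parity_hB B hs hA
  have hf := P.f_inv_comul hμ (cop_hB B hs hA)
    (IsDeconc.comul_barMap B.cop_bar BZ.cop_bar C.f) hσ hσh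
  have hg := P.inv_g_comul hμ (cop_hB B hs hA)
    (IsDeconc.comul_barMap BZ.cop_bar B.cop_bar C.g) hσ hσh hfkos hgkos
  have hd := P.f_perturbed_g_comul (cop_dB1 B hs hA) hμ hf
    (IsDeconc.comul_barMap BZ.cop_bar B.cop_bar C.g) hgkos
  have hTι := inv_ι B hA hT.2 hyp.2
  have hT'ι : ∀ a, ∃ b, T' (TensorAlgebra.ι F a) = TensorAlgebra.ι F b := by
    intro a
    obtain ⟨b, hb⟩ := hTι (B.mu (TensorAlgebra.ι F a))
    exact ⟨a - C.h b, by rw [P.inv_eq', mucod_ι B hA, hb, hB_ι B hA, map_sub]⟩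
  have hA₁ : ∀ a, ∃ b, (B.dB1 + B.mucod) (TensorAlgebra.ι F a) = TensorAlgebra.ι F b := fun a =>
    ⟨dA a + B.mu (TensorAlgebra.ι F a), by simp [dB1_ι B hA, mucod_ι B hA]⟩
  refine ⟨LinearMap.ext hd, LinearMap.ext P.f_perturbed_g_sq, LinearMap.ext hf,
    LinearMap.ext P.f_inv_chain, LinearMap.ext hg, LinearMap.ext P.inv_g_chain, ?_⟩
  have hf₁ : ∀ a, ∃ w, (barMap F Z A C.f ∘ₗ T) (TensorAlgebra.ι F a) = TensorAlgebra.ι F w := by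
    intro a
    obtain ⟨b, hb⟩ := hTι a
    exact ⟨C.f b, by simp [hb]⟩
  have hg₁ : ∀ z, ∃ b, (T' ∘ₗ barMap F A Z C.g) (TensorAlgebra.ι F z) = TensorAlgebra.ι F b := by
    intro z
    simpa using hT'ι (C.g z)
  have hZ₁ : ∀ z, ∃ w, (barMap F Z A C.f ∘ₗ B.dB1 ∘ₗ barMap F A Z C.g +
      barMap F Z A C.f ∘ₗ B.mucod ∘ₗ T' ∘ₗ barMap F A Z C.g) (TensorAlgebra.ι F z) =
        TensorAlgebra.ι F w := by
    intro z
    obtain ⟨b, hb⟩ := hT'ι (C.g z)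
    exact ⟨C.f (dA (C.g z)) + C.f (B.mu (TensorAlgebra.ι F b)), by
      simp [hb, dB1_ι B hA, mucod_ι B hA]⟩
  have hh₁ : ∀ a, ∃ b, (B.hB ∘ₗ T) (TensorAlgebra.ι F a) = TensorAlgebra.ι F b := by
    intro a
    obtain ⟨b, hb⟩ := hTι a
    exact ⟨C.h b, by simp [hb, hB_ι B hA]⟩
  refine isQuasiIso_of_homotopy (h := pA.pi ∘ₗ (B.hB ∘ₗ T) ∘ₗ TensorAlgebra.ι F)
    (fun a => ?_) (fun z => ?_) (fun z => ?_) fun a => ?_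
  · simp only [LinearMap.comp_apply (f := pA.pi), LinearMap.comp_apply (f := pZ.pi),
      LinearMap.comp_apply (g := TensorAlgebra.ι F), ι_proj pZ.pi_one (hf₁ _),
      ι_proj pA.pi_one (hA₁ _)]
    exact congrArg pZ.pi (P.f_inv_chain _)
  · simp only [LinearMap.comp_apply (f := pA.pi), LinearMap.comp_apply (f := pZ.pi),
      LinearMap.comp_apply (g := TensorAlgebra.ι F), ι_proj pA.pi_one (hg₁ _),
      ι_proj pZ.pi_one (hZ₁ _)]
    exact congrArg pA.pi (P.inv_g_chain _)
  · simp only [LinearMap.comp_apply (f := pA.pi), LinearMap.comp_apply (f := pZ.pi),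
      LinearMap.comp_apply (g := TensorAlgebra.ι F), ι_proj pA.pi_one (hg₁ _)]
    exact (congrArg pZ.pi (P.f_inv_inv_g _)).trans (pZ.pi_one z)
  · simp only [LinearMap.comp_apply (f := pA.pi), LinearMap.comp_apply (f := pZ.pi),
      LinearMap.comp_apply (g := TensorAlgebra.ι F), ι_proj pZ.pi_one (hf₁ _),
      ι_proj pA.pi_one (hA₁ _), ι_proj pA.pi_one (hh₁ _)]
    refine (congrArg pA.pi (P.inv_g_f_inv _)).trans ?_
    simp only [map_sub, map_add, pA.pi_one, LinearMap.add_apply, LinearMap.comp_apply]
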